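/- Let d ≥ 1, k ≥ 1 be fixed integers, s ∈ (0,2] and L > 0. There exists a constant C depending only on s, L, d and k such that for every n ≥ k, every probability density f in the Hölder ball H^s_d(L;[0,1]^d), and every x ∈ [0,1]^d, if X_1,…,X_n are i.i.d. samples from f and R_k(x) denotes the k-th smallest torus distance from x to X_1,…,X_n, then E[ f_{R_k(x)}(x) ] − f(x) ≤ C n^{−s/(s+d)}. -/

import Mathlib

open MeasureTheory Real

noncomputable section

abbrev Euc (d : ℕ) : Type := EuclideanSpace ℝ (Fin d)

/-- The unit cube `[0,1]^d`. -/
def unitCube (d : ℕ) : Set (Euc d) := {x | ∀ i, x i ∈ Set.Icc (0:ℝ) 1}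

/-- Volume of the unit Euclidean ball in `ℝ^d`. -/
def unitBallVol (d : ℕ) : ℝ := Real.pi ^ ((d : ℝ) / 2) / Real.Gamma (1 + (d : ℝ) / 2)

/-- The point of `ℝ^d` with integer coordinates `m`. -/
def intVec (d : ℕ) (m : Fin d → ℤ) : Euc d :=
  (WithLp.equiv 2 (Fin d → ℝ)).symm fun i => (m i : ℝ)

/-- Torus distance: `d(x,y) = min_{m ∈ ℤ^d} ‖x + m - y‖`. -/
def torusDist (d : ℕ) (x y : Euc d) : ℝ :=
  ⨅ m : Fin d → ℤ, ‖x + intVec d m - y‖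

/-- `(s,L)`-Hölder condition for `s ∈ (0,2]`. -/
def IsHolderOrder (d : ℕ) (s L : ℝ) (f : Euc d → ℝ) : Prop :=
  if s ≤ 1 then
    ∀ x y : Euc d, |f x - f y| ≤ L * ‖x - y‖ ^ s
  else
    ContDiff ℝ 1 f ∧ ∀ x y : Euc d, ‖gradient f x - gradient f y‖ ≤ L * ‖x - y‖ ^ (s - 1)

/-- `f` is 1-periodic in each coordinate. -/
def IsPeriodic (d : ℕ) (f : Euc d → ℝ) : Prop :=
  ∀ (x : Euc d) (i : Fin d), f (x + EuclideanSpace.single i 1) = f x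

/-- Probability density in the Hölder ball `H^s_d(L;[0,1]^d)`, represented by its
1-periodic extension to `ℝ^d`. -/
def HolderDensity (d : ℕ) (s L : ℝ) (f : Euc d → ℝ) : Prop :=
  IsHolderOrder d s L f ∧ IsPeriodic d f ∧ (∀ x, 0 ≤ f x) ∧
    (∫ x in unitCube d, f x) = 1

/-- The probability measure on `[0,1]^d` with density `f`. -/
def densityMeasure (d : ℕ) (f : Euc d → ℝ) : Measure (Euc d) :=
  (volume.restrict (unitCube d)).withDensity fun x => ENNReal.ofReal (f x)

/-- Law of `n` i.i.d. samples from density `f`. -/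
def sampleMeasure (d n : ℕ) (f : Euc d → ℝ) : Measure (Fin n → Euc d) :=
  Measure.pi fun _ => densityMeasure d f

/-- The `k`-th smallest element (1-indexed) of a multiset of reals. -/
def kthSmallest (s : Multiset ℝ) (k : ℕ) : ℝ :=
  (s.sort (· ≤ ·)).getD (k - 1) 0

/-- `R_{i,k}`: the `k`-nearest neighbor torus distance from `X i` to the other points. -/
def nnDist (d n : ℕ) (X : Fin n → Euc d) (i : Fin n) (k : ℕ) : ℝ :=
  kthSmallest ((Finset.univ.erase i).val.map fun j => torusDist d (X i) (X j)) k

/-- The digamma function: derivative of `ln Γ`. -/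
def digamma (x : ℝ) : ℝ := deriv (fun y => Real.log (Real.Gamma y)) x

/-- The Kozachenko–Leonenko `k`-nearest neighbor differential entropy estimator. -/
def klEstimator (d k n : ℕ) (X : Fin n → Euc d) : ℝ :=
  Real.log k - digamma k +
    (1 / n : ℝ) * ∑ i : Fin n, Real.log ((n / k : ℝ) * (unitBallVol d * nnDist d n X i k ^ d))

/-- Differential entropy `h(f) = -∫_{[0,1]^d} f ln f`. -/
def diffEntropy (d : ℕ) (f : Euc d → ℝ) : ℝ :=
  -∫ x in unitCube d, f x * Real.log (f x)

end

noncomputable section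

/-- `f_t(x)`: the average of `f` over the closed Euclidean ball `B(x,t)`,
`f_t(x) = (1/(V_d t^d)) ∫_{‖u-x‖ ≤ t} f(u) du`. -/
def ballAvg (d : ℕ) (f : Euc d → ℝ) (t : ℝ) (x : Euc d) : ℝ :=
  (1 / (unitBallVol d * t ^ d)) * ∫ u in Metric.closedBall x t, f u

/-- `R_k(x)`: the `k`-th smallest torus distance from the point `x` to the sample points. -/
def RkOfPoint (d n k : ℕ) (x : Euc d) (X : Fin n → Euc d) : ℝ :=
  kthSmallest (Finset.univ.val.map fun j : Fin n => torusDist d x (X j)) k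

end

noncomputable section

theorem card_filter_le_lt_of_lt_kthSmallest {ι : Type*} [Fintype ι] (D : ι → ℝ) {k : ℕ}
    (hk : 1 ≤ k) {t : ℝ} (ht : t < kthSmallest (Finset.univ.val.map D) k)
    (hkn : k ≤ Fintype.card ι) :
    (Finset.univ.filter fun j => D j ≤ t).card < k := by
  classical
  set l := (Finset.univ.val.map D).sort (· ≤ ·) with hl
  have hlen : l.length = Fintype.card ι := by simp [hl, Finset.card_univ]
  have hsort : l.Pairwise (· ≤ ·) := Multiset.pairwise_sort _ _
  have hcount : (Finset.univ.filter fun j => D j ≤ t).card = l.countP (fun a => a ≤ t) := by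
    rw [← Multiset.coe_countP, hl, Multiset.sort_eq, Multiset.countP_map]
    rfl
  have hlt : k - 1 < l.length := by omega
  have hget : t < l[k - 1] := by
    have h := ht
    rw [kthSmallest, ← hl, List.getD_eq_getElem _ _ hlt] at h
    exact h
  have hdrop : (l.drop (k - 1)).countP (fun a => a ≤ t) = 0 := by
    rw [List.countP_eq_zero]
    intro a ha
    obtain ⟨i, hi, rfl⟩ := List.getElem_of_mem ha
    rw [List.getElem_drop]
    rw [List.length_drop] at hi
    have hle : l[k - 1] ≤ l[k - 1 + i] :=
      hsort.sortedLE.getElem_le_getElem_of_le (by omega)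
    simpa using hget.trans_le hle
  have htake : (l.take (k - 1)).countP (fun a => a ≤ t) ≤ k - 1 :=
    List.countP_le_length.trans (List.length_take_le _ _)
  rw [hcount, ← List.take_append_drop (k - 1) l, List.countP_append, hdrop]
  omega

theorem exists_kthSmallest_eq {ι : Type*} [Fintype ι] (D : ι → ℝ) {k : ℕ}
    (hk : 1 ≤ k) (hkn : k ≤ Fintype.card ι) :
    ∃ j, kthSmallest (Finset.univ.val.map D) k = D j := by
  have hlt : k - 1 < ((Finset.univ.val.map D).sort (· ≤ ·)).length := by
    simp only [Multiset.length_sort, Multiset.card_map, Finset.card_val, Finset.card_univ]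
    omega
  have hmem := List.getElem_mem hlt
  rw [Multiset.mem_sort, Multiset.mem_map] at hmem
  obtain ⟨j, -, hj⟩ := hmem
  exact ⟨j, by rw [kthSmallest, List.getD_eq_getElem _ _ hlt, hj]⟩

/-- At most `k` entries of a finite family are preceded by fewer than `k` of the others. -/
theorem card_filter_card_succAbove_lt_le {n : ℕ} (D : Fin (n + 1) → ℝ) (k : ℕ) :
    (Finset.univ.filter fun i : Fin (n + 1) =>
      (Finset.univ.filter fun j : Fin n => D (i.succAbove j) ≤ D i).card < k).card ≤ k := by
  classical
  set A := Finset.univ.filter fun i : Fin (n + 1) =>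
      (Finset.univ.filter fun j : Fin n => D (i.succAbove j) ≤ D i).card < k with hA
  rcases A.eq_empty_or_nonempty with h | h
  · simp [h]
  obtain ⟨i, hi, hmax⟩ := A.exists_max_image D h
  have hik : (Finset.univ.filter fun j : Fin n => D (i.succAbove j) ≤ D i).card < k :=
    (Finset.mem_filter.1 hi).2
  have hsub : A.erase i ⊆
      (Finset.univ.filter fun j : Fin n => D (i.succAbove j) ≤ D i).image i.succAbove := by
    intro a ha
    obtain ⟨hne, haA⟩ := Finset.mem_erase.1 ha
    obtain ⟨j, rfl⟩ := Fin.exists_succAbove_eq hne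
    exact Finset.mem_image_of_mem _ (Finset.mem_filter.2 ⟨Finset.mem_univ _, hmax _ haA⟩)
  have hcard := (Finset.card_le_card hsub).trans Finset.card_image_le
  rw [Finset.card_erase_of_mem hi] at hcard
  omega

theorem measurableSet_card_filter_le_lt {α : Type*} [MeasurableSpace α] {T : α → ℝ}
    (hT : Measurable T) (n k : ℕ) :
    MeasurableSet {p : α × (Fin n → α) |
      (Finset.univ.filter fun j => T (p.2 j) ≤ T p.1).card < k} := by
  have hmeas : Measurable fun p : α × (Fin n → α) =>
      (Finset.univ.filter fun j => T (p.2 j) ≤ T p.1).card := by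
    simp only [Finset.card_filter]
    refine Finset.measurable_sum _ fun j _ => ?_
    refine Measurable.ite (measurableSet_le ?_ ?_) measurable_const measurable_const
    · exact hT.comp ((measurable_pi_apply j).comp measurable_snd)
    · exact hT.comp measurable_fst
  exact hmeas (measurableSet_lt measurable_id measurable_const)

/-- By exchangeability, the expected mass of the points ranking strictly among the first `k`
when added to an i.i.d. sample of size `n` is at most `k / (n + 1)`. -/
theorem lintegral_measure_card_filter_le_lt_le {α : Type*} [MeasurableSpace α] (μ : Measure α)
    [IsProbabilityMeasure μ] {T : α → ℝ} (hT : Measurable T) (n k : ℕ) :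
    ((n : ENNReal) + 1) * ∫⁻ X : Fin n → α,
      μ {y | (Finset.univ.filter fun j => T (X j) ≤ T y).card < k} ∂(Measure.pi fun _ => μ)
      ≤ k := by
  set E : Set (α × (Fin n → α)) :=
    {p | (Finset.univ.filter fun j => T (p.2 j) ≤ T p.1).card < k} with hE
  have hEm : MeasurableSet E := measurableSet_card_filter_le_lt hT n k
  set P : Measure (Fin (n + 1) → α) := Measure.pi fun _ => μ with hP
  have hint : ∫⁻ X : Fin n → α,
      μ {y | (Finset.univ.filter fun j => T (X j) ≤ T y).card < k} ∂(Measure.pi fun _ => μ)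
      = (μ.prod (Measure.pi fun _ : Fin n => μ)) E := by
    rw [Measure.prod_apply_symm hEm]
    rfl
  let e (i : Fin (n + 1)) := MeasurableEquiv.piFinSuccAbove (fun _ : Fin (n + 1) => α) i
  have hpre (i : Fin (n + 1)) :
      P (e i ⁻¹' E) = (μ.prod (Measure.pi fun _ : Fin n => μ)) E :=
    (measurePreserving_piFinSuccAbove (fun _ : Fin (n + 1) => μ) i).measure_preimage
      hEm.nullMeasurableSet
  have hme (i : Fin (n + 1)) : MeasurableSet (e i ⁻¹' E) := (e i).measurable hEm
  calc ((n : ENNReal) + 1) * ∫⁻ X : Fin n → α,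
        μ {y | (Finset.univ.filter fun j => T (X j) ≤ T y).card < k} ∂(Measure.pi fun _ => μ)
      = ∑ i : Fin (n + 1), P (e i ⁻¹' E) := by
        simp only [hpre, hint, Finset.sum_const, Finset.card_univ, Fintype.card_fin, nsmul_eq_mul]
        push_cast
        rfl
    _ = ∫⁻ Y, ∑ i : Fin (n + 1), (e i ⁻¹' E).indicator 1 Y ∂P := by
        rw [lintegral_finsetSum _ fun i _ => measurable_one.indicator (hme i)]
        simp only [lintegral_indicator_one (hme _)]
    _ ≤ ∫⁻ _, (k : ENNReal) ∂P := by
        refine lintegral_mono fun Y => ?_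
        classical
        have hY := card_filter_card_succAbove_lt_le (fun i => T (Y i)) k
        have hsum : ∑ i : Fin (n + 1), (e i ⁻¹' E).indicator (1 : (Fin (n + 1) → α) → ENNReal) Y
            = ((Finset.univ.filter fun i : Fin (n + 1) =>
              (Finset.univ.filter fun j : Fin n =>
                T (Y (i.succAbove j)) ≤ T (Y i)).card < k).card : ENNReal) := by
          rw [Finset.card_filter]
          push_cast
          refine Finset.sum_congr rfl fun i _ => ?_
          rw [Set.indicator_apply]
          exact if_congr Iff.rfl rfl rfl
        rw [hsum]
        exact Nat.cast_le.2 hY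
    _ = k := by simp [hP]

theorem bddBelow_range_norm_add_intVec_sub (d : ℕ) (x y : Euc d) :
    BddBelow (Set.range fun m : Fin d → ℤ => ‖x + intVec d m - y‖) :=
  ⟨0, by rintro _ ⟨m, rfl⟩; exact norm_nonneg _⟩

theorem torusDist_nonneg (d : ℕ) (x y : Euc d) : 0 ≤ torusDist d x y :=
  Real.iInf_nonneg fun _ => norm_nonneg _

theorem measurable_torusDist (d : ℕ) (x : Euc d) : Measurable (torusDist d x) :=
  Measurable.iInf fun _ => (continuous_const.sub continuous_id).norm.measurable

theorem intVec_apply (d : ℕ) (m : Fin d → ℤ) (i : Fin d) : intVec d m i = m i := rfl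

theorem intVec_neg (d : ℕ) (m : Fin d → ℤ) : intVec d (-m) = -intVec d m := by
  ext i
  simp [intVec_apply]

theorem torusDist_le_sqrt (d : ℕ) (x y : Euc d) : torusDist d x y ≤ √d := by
  refine (ciInf_le (bddBelow_range_norm_add_intVec_sub d x y) fun i => ⌊y i - x i⌋).trans ?_
  rw [EuclideanSpace.norm_eq]
  refine Real.sqrt_le_sqrt ?_
  calc _ ≤ ∑ _i : Fin d, (1 : ℝ) := by
        refine Finset.sum_le_sum fun i _ => ?_
        rw [sq_le_one_iff_abs_le_one, abs_norm, Real.norm_eq_abs, abs_le]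
        have h1 := Int.floor_le (y i - x i)
        have h2 := Int.lt_floor_add_one (y i - x i)
        simp only [PiLp.sub_apply, PiLp.add_apply, intVec_apply]
        constructor <;> linarith
    _ = d := by simp

theorem torusDist_lt_of_add_intVec_mem_ball {d : ℕ} {x u : Euc d} {m : Fin d → ℤ} {r : ℝ}
    (h : u + intVec d m ∈ Metric.ball x r) : torusDist d x u < r := by
  refine (ciInf_le (bddBelow_range_norm_add_intVec_sub d x u) (-m)).trans_lt ?_
  rw [Metric.mem_ball', dist_eq_norm] at h
  rwa [intVec_neg, ← sub_eq_add_neg, sub_right_comm, sub_sub]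

theorem IsPeriodic.add_intVec {d : ℕ} {f : Euc d → ℝ} (hf : IsPeriodic d f) (m : Fin d → ℤ)
    (u : Euc d) : f (u + intVec d m) = f u := by
  have hnat (i : Fin d) (c : ℕ) (u : Euc d) : f (u + (c : ℝ) • EuclideanSpace.single i 1) = f u := by
    induction c with
    | zero => simp
    | succ c ih => rw [Nat.cast_succ, add_smul, one_smul, ← add_assoc, hf, ih]
  have hint (i : Fin d) (c : ℤ) (u : Euc d) : f (u + (c : ℝ) • EuclideanSpace.single i 1) = f u := by
    obtain ⟨a, rfl | rfl⟩ := c.eq_nat_or_neg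
    · exact_mod_cast hnat i a u
    · rw [← hnat i a (u + _), add_assoc, ← add_smul]
      simp
  have hsum : ∀ (s : Finset (Fin d)) (u : Euc d),
      f (u + ∑ i ∈ s, (m i : ℝ) • EuclideanSpace.single i 1) = f u := by
    intro s
    induction s using Finset.induction_on with
    | empty => simp
    | insert i s hi ih =>
      intro u
      rw [Finset.sum_insert hi, ← add_assoc, ih, hint]
  rw [← hsum Finset.univ u]
  congr 2
  ext i
  simp [intVec_apply, Finset.sum_apply, Pi.single_apply]

theorem measurableSet_unitCube (d : ℕ) : MeasurableSet (unitCube d) := by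
  simp only [unitCube, Set.ofPred_forall]
  exact MeasurableSet.iInter fun i =>
    (EuclideanSpace.proj (𝕜 := ℝ) i).continuous.measurable measurableSet_Icc

/-- The translations by integer vectors preserve a measure with periodic density. -/
theorem IsPeriodic.measurePreserving_add_intVec {d : ℕ} {f : Euc d → ℝ} (hf : IsPeriodic d f)
    (hfm : Measurable f) (m : Fin d → ℤ) :
    MeasurePreserving (fun u => u + intVec d m)
      (volume.withDensity fun u => ENNReal.ofReal (f u))
      (volume.withDensity fun u => ENNReal.ofReal (f u)) := by
  refine ⟨measurable_add_const _, Measure.ext fun A hA => ?_⟩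
  rw [Measure.map_apply (measurable_add_const _) hA, withDensity_apply _ hA,
    withDensity_apply _ (measurable_add_const _ hA),
    ← (measurePreserving_add_right volume (intVec d m)).setLIntegral_comp_preimage hA
      hfm.ennreal_ofReal]
  simp only [hf.add_intVec]

theorem withDensity_ball_le {d : ℕ} {f : Euc d → ℝ} (hf : IsPeriodic d f) (hfm : Measurable f)
    {x : Euc d} (hx : x ∈ unitCube d) {r : ℝ} (hr : r ≤ √d) :
    (volume.withDensity fun u => ENNReal.ofReal (f u)) (Metric.ball x r) ≤
      ((2 * d + 1) ^ d : ℕ) * densityMeasure d f {u | torusDist d x u < r} := by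
  set ν : Measure (Euc d) := volume.withDensity fun u => ENNReal.ofReal (f u) with hν
  have hdens : densityMeasure d f = ν.restrict (unitCube d) :=
    (restrict_withDensity (measurableSet_unitCube d) _).symm
  have hTm : MeasurableSet {u | torusDist d x u < r} :=
    measurable_torusDist d x measurableSet_Iio
  let S : Finset (Fin d → ℤ) := Fintype.piFinset fun _ => Finset.Icc (-d : ℤ) d
  have hS : S.card = (2 * d + 1) ^ d := by
    simp only [S, Fintype.card_piFinset, Int.card_Icc, Finset.prod_const, Finset.card_univ,
      Fintype.card_fin]
    congr 1
    omega
  have hcover : Metric.ball x r ⊆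
      ⋃ m ∈ S, (fun u => u + intVec d (-m)) ⁻¹' ({u | torusDist d x u < r} ∩ unitCube d) := by
    intro u hu
    have hd : √(d : ℝ) ≤ d := by
      rcases Nat.eq_zero_or_pos d with h | h
      · simp [h]
      · have h1 : (1 : ℝ) ≤ d := by exact_mod_cast h
        exact Real.sqrt_le_iff.2 ⟨by positivity, by nlinarith⟩
    have hux (i : Fin d) : |u i - x i| < d := by
      have h1 := PiLp.norm_apply_le (u - x) i
      rw [Metric.mem_ball, dist_eq_norm] at hu
      rw [PiLp.sub_apply, Real.norm_eq_abs] at h1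
      linarith
    refine Set.mem_biUnion (x := fun i => ⌊u i⌋) ?_ ⟨?_, fun i => ?_⟩
    · refine Finset.mem_coe.2 (Fintype.mem_piFinset.2 fun i => Finset.mem_Icc.2 ⟨?_, ?_⟩)
      · have h1 := (abs_lt.1 (hux i)).1
        have h2 := (hx i).1
        exact Int.le_floor.2 (by push_cast; linarith)
      · have h1 := (abs_lt.1 (hux i)).2
        have h2 := (hx i).2
        exact Int.lt_add_one_iff.1 (Int.floor_lt.2 (by push_cast; linarith))
    · refine torusDist_lt_of_add_intVec_mem_ball (m := fun i => ⌊u i⌋) ?_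
      rwa [intVec_neg, neg_add_cancel_right]
    · have h1 := Int.floor_le (u i)
      have h2 := Int.lt_floor_add_one (u i)
      simp only [PiLp.add_apply, intVec_apply, Pi.neg_apply, Set.mem_Icc]
      push_cast
      constructor <;> linarith
  calc ν (Metric.ball x r)
      ≤ ∑ m ∈ S, ν ((fun u => u + intVec d (-m)) ⁻¹'
          ({u | torusDist d x u < r} ∩ unitCube d)) :=
        (measure_mono hcover).trans (measure_biUnion_finset_le _ _)
    _ = ∑ _m ∈ S, densityMeasure d f {u | torusDist d x u < r} := by
        refine Finset.sum_congr rfl fun m _ => ?_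
        rw [(hf.measurePreserving_add_intVec hfm (-m)).measure_preimage
          (hTm.inter (measurableSet_unitCube d)).nullMeasurableSet, hdens,
          Measure.restrict_apply hTm]
    _ = _ := by rw [Finset.sum_const, hS, nsmul_eq_mul]

theorem isProbabilityMeasure_densityMeasure {d : ℕ} {s L : ℝ} {f : Euc d → ℝ}
    (hf : HolderDensity d s L f) : IsProbabilityMeasure (densityMeasure d f) := by
  obtain ⟨-, -, h0, h1⟩ := hf
  have hint : Integrable f (volume.restrict (unitCube d)) := by
    by_contra h
    rw [integral_undef h] at h1
    exact zero_ne_one h1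
  refine ⟨?_⟩
  rw [densityMeasure, withDensity_apply _ MeasurableSet.univ, Measure.restrict_univ,
    ← ofReal_integral_eq_lintegral_ofReal hint (ae_of_all _ h0), h1, ENNReal.ofReal_one]

theorem IsHolderOrder.continuous {d : ℕ} {s L : ℝ} {f : Euc d → ℝ} (hs : 0 < s)
    (hf : IsHolderOrder d s L f) : Continuous f := by
  rw [IsHolderOrder] at hf
  split_ifs at hf
  · refine continuous_iff_continuousAt.2 fun x => ?_
    rw [ContinuousAt, tendsto_iff_dist_tendsto_zero]
    refine squeeze_zero (fun _ => dist_nonneg) (fun y => hf y x) ?_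
    have hcont : Continuous fun y : Euc d => L * ‖y - x‖ ^ s :=
      continuous_const.mul ((continuous_id.sub continuous_const).norm.rpow_const
        fun _ => Or.inr hs.le)
    simpa [Real.zero_rpow hs.ne'] using hcont.tendsto x
  · exact hf.1.continuous

theorem IsHolderOrder.exists_le_add_clm {d : ℕ} {s L : ℝ} {f : Euc d → ℝ} (hs : 0 < s)
    (hL : 0 ≤ L) (hf : IsHolderOrder d s L f) (x : Euc d) {t : ℝ} (ht : 0 < t) :
    ∃ φ : Euc d →L[ℝ] ℝ, ∀ u ∈ Metric.closedBall x t, f u ≤ f x + L * t ^ s + φ (u - x) := by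
  rw [IsHolderOrder] at hf
  split_ifs at hf with h1
  · refine ⟨0, fun u hu => ?_⟩
    rw [Metric.mem_closedBall, dist_eq_norm] at hu
    have h2 := (le_abs_self _).trans (hf u x)
    have h3 : L * ‖u - x‖ ^ s ≤ L * t ^ s := by gcongr
    simp only [zero_apply]
    linarith
  · push Not at h1
    obtain ⟨hdiff, hgrad⟩ := hf
    refine ⟨fderiv ℝ f x, fun u hu => ?_⟩
    have hbound : ∀ y ∈ Metric.closedBall x t, ‖fderiv ℝ f y - fderiv ℝ f x‖ ≤ L * t ^ (s - 1) := by
      intro y hy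
      rw [Metric.mem_closedBall, dist_eq_norm] at hy
      have h2 := hgrad y x
      rw [gradient, gradient, ← map_sub, LinearIsometryEquiv.norm_map] at h2
      exact h2.trans (by have := sub_pos.2 h1; gcongr)
    have hmv := Convex.norm_image_sub_le_of_norm_fderiv_le'
      (fun y _ => (hdiff.differentiable one_ne_zero).differentiableAt) hbound
      (convex_closedBall x t) (Metric.mem_closedBall_self ht.le) hu
    rw [Metric.mem_closedBall, dist_eq_norm] at hu
    have h3 : L * t ^ (s - 1) * ‖u - x‖ ≤ L * t ^ s := by
      calc L * t ^ (s - 1) * ‖u - x‖ ≤ L * t ^ (s - 1) * t := by gcongr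
        _ = L * t ^ s := by rw [mul_assoc, ← Real.rpow_add_one ht.ne', sub_add_cancel]
    have h4 := (Real.le_norm_self _).trans hmv
    linarith

theorem setIntegral_closedBall_clm_sub {d : ℕ} (φ : Euc d →L[ℝ] ℝ) (x : Euc d) (t : ℝ) :
    ∫ u in Metric.closedBall x t, φ (u - x) = 0 := by
  have hmp := Measure.measurePreserving_sub_left (volume : Measure (Euc d)) (x + x)
  have h := hmp.setIntegral_preimage_emb (MeasurableEquiv.subLeft (x + x)).measurableEmbedding
    (fun u => φ (u - x)) (Metric.closedBall x t)
  have hpre : (fun u => x + x - u) ⁻¹' Metric.closedBall x t = Metric.closedBall x t := by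
    ext u
    rw [Set.mem_preimage, Metric.mem_closedBall, Metric.mem_closedBall', dist_eq_norm,
      dist_eq_norm]
    congr! 2
    abel
  have hneg (u : Euc d) : φ (x + x - u - x) = -φ (u - x) := by
    rw [← map_neg]
    congr 1
    abel
  rw [hpre] at h
  simp only [hneg, integral_neg] at h
  linarith

theorem unitBallVol_pos (d : ℕ) : 0 < unitBallVol d :=
  div_pos (Real.rpow_pos_of_pos Real.pi_pos _) (Real.Gamma_pos_of_pos (by positivity))

theorem volume_real_closedBall {d : ℕ} (hd : 1 ≤ d) (x : Euc d) {t : ℝ} (ht : 0 ≤ t) :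
    (volume : Measure (Euc d)).real (Metric.closedBall x t) = unitBallVol d * t ^ d := by
  have : Nonempty (Fin d) := ⟨⟨0, hd⟩⟩
  have hpi : √Real.pi ^ d = Real.pi ^ ((d : ℝ) / 2) := by
    rw [Real.sqrt_eq_rpow, ← Real.rpow_natCast, ← Real.rpow_mul Real.pi_pos.le]
    congr 1
    ring
  have hV : √Real.pi ^ d / Real.Gamma ((d : ℝ) / 2 + 1) = unitBallVol d := by
    rw [unitBallVol, hpi, add_comm]
  rw [Measure.real, EuclideanSpace.volume_closedBall, Fintype.card_fin, hV, ENNReal.toReal_mul,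
    ENNReal.toReal_pow, ENNReal.toReal_ofReal ht, ENNReal.toReal_ofReal (unitBallVol_pos d).le,
    mul_comm]

/-- The ball averages of a Hölder function exceed its value at the centre by at most `L t ^ s`:
for `s > 1` the linear term cancels by symmetry. -/
theorem IsHolderOrder.ballAvg_le {d : ℕ} (hd : 1 ≤ d) {s L : ℝ} {f : Euc d → ℝ} (hs : 0 < s)
    (hL : 0 ≤ L) (hf : IsHolderOrder d s L f) (x : Euc d) {t : ℝ} (ht : 0 < t) :
    ballAvg d f t x ≤ f x + L * t ^ s := by
  obtain ⟨φ, hφ⟩ := hf.exists_le_add_clm hs hL x ht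
  have hcompact := isCompact_closedBall x t
  have hVt : 0 < unitBallVol d * t ^ d := mul_pos (unitBallVol_pos d) (by positivity)
  have hφc : Continuous fun u => φ (u - x) := φ.continuous.comp (continuous_id.sub continuous_const)
  have hφint := hφc.continuousOn.integrableOn_compact (μ := volume) hcompact
  have hcint := (continuous_const (y := f x + L * t ^ s)).continuousOn.integrableOn_compact
    (μ := volume) hcompact
  have hle : ∫ u in Metric.closedBall x t, f u ≤ unitBallVol d * t ^ d * (f x + L * t ^ s) := by
    calc ∫ u in Metric.closedBall x t, f u
        ≤ ∫ u in Metric.closedBall x t, (f x + L * t ^ s + φ (u - x)) :=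
          setIntegral_mono_on ((hf.continuous hs).continuousOn.integrableOn_compact hcompact)
            (hcint.add hφint) Metric.isClosed_closedBall.measurableSet hφ
      _ = unitBallVol d * t ^ d * (f x + L * t ^ s) := by
          rw [integral_add hcint hφint, setIntegral_closedBall_clm_sub, setIntegral_const,
            volume_real_closedBall hd x ht.le, smul_eq_mul, add_zero]
  rw [ballAvg, one_div, inv_mul_le_iff₀ hVt]
  exact hle

theorem ballAvg_nonneg {d : ℕ} {f : Euc d → ℝ} (hf : ∀ u, 0 ≤ f u) {t : ℝ} (ht : 0 ≤ t)
    (x : Euc d) : 0 ≤ ballAvg d f t x :=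
  mul_nonneg (one_div_nonneg.2 (mul_nonneg (unitBallVol_pos d).le (by positivity)))
    (integral_nonneg hf)

theorem ballAvg_le_measureReal_torusDist_lt {d : ℕ} {s L : ℝ} {f : Euc d → ℝ} (hs : 0 < s)
    (hf : HolderDensity d s L f) {x : Euc d} (hx : x ∈ unitCube d) {t r : ℝ} (ht : 0 < t)
    (htr : t ≤ r) (hr : r ≤ √d) :
    ballAvg d f r x ≤ (2 * d + 1) ^ d / (unitBallVol d * t ^ d) *
      (densityMeasure d f).real {u | torusDist d x u < r} := by
  have := isProbabilityMeasure_densityMeasure hf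
  obtain ⟨hholder, hper, h0, -⟩ := hf
  have hfc := hholder.continuous hs
  set ν : Measure (Euc d) := volume.withDensity fun u => ENNReal.ofReal (f u) with hν
  have hr0 : 0 < r := ht.trans_le htr
  have hball : ν (Metric.closedBall x r) = ν (Metric.ball x r) := by
    refine le_antisymm ?_ (measure_mono Metric.ball_subset_closedBall)
    rw [← Metric.ball_union_sphere]
    refine (measure_union_le _ _).trans_eq ?_
    rw [withDensity_absolutelyContinuous _ _
      (Measure.addHaar_sphere_of_ne_zero volume x hr0.ne'), add_zero]
  have hint : ∫ u in Metric.closedBall x r, f u = ν.real (Metric.closedBall x r) := by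
    rw [integral_eq_lintegral_of_nonneg_ae (ae_of_all _ h0) hfc.aestronglyMeasurable, Measure.real,
      withDensity_apply _ Metric.isClosed_closedBall.measurableSet]
  have hle : ν.real (Metric.closedBall x r) ≤
      (2 * d + 1) ^ d * (densityMeasure d f).real {u | torusDist d x u < r} := by
    have h := ENNReal.toReal_mono
      (ENNReal.mul_ne_top (ENNReal.natCast_ne_top _) (measure_ne_top _ _))
      (withDensity_ball_le hper hfc.measurable hx hr)
    rw [ENNReal.toReal_mul, ENNReal.toReal_natCast] at h
    rw [Measure.real, hball]
    exact_mod_cast h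
  have hV := unitBallVol_pos d
  rw [ballAvg, hint, one_div, div_mul_eq_mul_div, ← div_eq_inv_mul]
  gcongr

/-- The bias bound with an explicit truncation radius `t`. -/
theorem integral_ballAvg_RkOfPoint_le {d n k : ℕ} (hd : 1 ≤ d) (hk : 1 ≤ k) (hkn : k ≤ n)
    {s L : ℝ} (hs : 0 < s) (hL : 0 ≤ L) {f : Euc d → ℝ} (hf : HolderDensity d s L f)
    {x : Euc d} (hx : x ∈ unitCube d) {t : ℝ} (ht : 0 < t) :
    ∫ X, ballAvg d f (RkOfPoint d n k x X) x ∂sampleMeasure d n f ≤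
      f x + L * t ^ s + (2 * d + 1) ^ d / (unitBallVol d * t ^ d) * (k / (n + 1)) := by
  have := isProbabilityMeasure_densityMeasure hf
  set μ := densityMeasure d f with hμ
  have hprob : IsProbabilityMeasure (sampleMeasure d n f) := by
    rw [sampleMeasure]
    infer_instance
  have hV := unitBallVol_pos d
  set c : ℝ := (2 * d + 1) ^ d / (unitBallVol d * t ^ d) with hc
  have hc0 : 0 ≤ c := by positivity
  let G (X : Fin n → Euc d) : Set (Euc d) :=
    {y | (Finset.univ.filter fun j => torusDist d x (X j) ≤ torusDist d x y).card < k}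
  have hT := measurable_torusDist d x
  have hGm : Measurable fun X => μ (G X) :=
    measurable_measure_prodMk_right (measurableSet_card_filter_le_lt hT n k)
  have hGint : Integrable (fun X => μ.real (G X)) (sampleMeasure d n f) :=
    Integrable.of_bound hGm.ennreal_toReal.aestronglyMeasurable 1
      (ae_of_all _ fun X => by simp [abs_of_nonneg, measureReal_le_one])
  have hGle : ∫ X, μ.real (G X) ∂sampleMeasure d n f ≤ k / (n + 1) := by
    have h := lintegral_measure_card_filter_le_lt_le μ hT n k
    have h2 : ∫ X, μ.real (G X) ∂sampleMeasure d n f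
        = (∫⁻ X, μ (G X) ∂sampleMeasure d n f).toReal :=
      integral_toReal hGm.aemeasurable (ae_of_all _ fun X => measure_lt_top _ _)
    rw [h2, le_div_iff₀ (by positivity), mul_comm]
    have h3 := ENNReal.toReal_mono (ENNReal.natCast_ne_top k) h
    rw [ENNReal.toReal_mul, ENNReal.toReal_natCast] at h3
    exact_mod_cast h3
  have hR (X : Fin n → Euc d) :
      0 ≤ RkOfPoint d n k x X ∧ RkOfPoint d n k x X ≤ √d := by
    obtain ⟨j, hj⟩ := exists_kthSmallest_eq (fun j : Fin n => torusDist d x (X j)) hk (by simpa)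
    rw [RkOfPoint, hj]
    exact ⟨torusDist_nonneg d _ _, torusDist_le_sqrt d _ _⟩
  have hbound (X : Fin n → Euc d) :
      ballAvg d f (RkOfPoint d n k x X) x ≤ f x + L * t ^ s + c * μ.real (G X) := by
    obtain ⟨hR0, hRd⟩ := hR X
    have hG0 : 0 ≤ c * μ.real (G X) := by positivity
    rcases le_total (RkOfPoint d n k x X) t with h | h
    · refine le_add_of_le_of_nonneg ?_ hG0
      rcases hR0.eq_or_lt with h0 | h0
      · rw [← h0, ballAvg, zero_pow (by omega)]
        have hfx := hf.2.2.1 x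
        simp only [mul_zero, div_zero, zero_mul]
        positivity
      · exact (hf.1.ballAvg_le hd hs hL x h0).trans (by gcongr)
    · refine (ballAvg_le_measureReal_torusDist_lt hs hf hx ht h hRd).trans ?_
      have hsub : {u | torusDist d x u < RkOfPoint d n k x X} ⊆ G X := fun u hu =>
        card_filter_le_lt_of_lt_kthSmallest _ hk hu (by simpa)
      have hmono : c * μ.real {u | torusDist d x u < RkOfPoint d n k x X} ≤ c * μ.real (G X) :=
        mul_le_mul_of_nonneg_left (measureReal_mono hsub (measure_ne_top μ _)) hc0
      have hfx := hf.2.2.1 x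
      have : 0 ≤ L * t ^ s := by positivity
      linarith
  calc ∫ X, ballAvg d f (RkOfPoint d n k x X) x ∂sampleMeasure d n f
      ≤ ∫ X, (f x + L * t ^ s + c * μ.real (G X)) ∂sampleMeasure d n f :=
        integral_mono_of_nonneg (ae_of_all _ fun X => ballAvg_nonneg hf.2.2.1 (hR X).1 x)
          ((integrable_const _).add (hGint.const_mul c)) (ae_of_all _ hbound)
    _ = f x + L * t ^ s + c * ∫ X, μ.real (G X) ∂sampleMeasure d n f := by
        rw [integral_add (integrable_const _) (hGint.const_mul c), integral_const_mul]
        simp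
    _ ≤ _ := by gcongr

/-- Pointwise bias bound for the `k`-NN density estimate:
`E[f_{R_k(x)}(x)] - f(x) ≤ C n^{-s/(s+d)}`. -/
theorem knn_density_bias_upper_bound (d k : ℕ) (hd : 1 ≤ d) (hk : 1 ≤ k)
    (s L : ℝ) (hs : 0 < s) (hs2 : s ≤ 2) (hL : 0 < L) :
    ∃ C : ℝ, 0 < C ∧ ∀ n : ℕ, k ≤ n → ∀ f : Euc d → ℝ, HolderDensity d s L f →
      ∀ x ∈ unitCube d,
        (∫ X, ballAvg d f (RkOfPoint d n k x X) x ∂ sampleMeasure d n f) - f x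
          ≤ C * (n : ℝ) ^ (-(s / (s + d))) := by
  have hV := unitBallVol_pos d
  refine ⟨L + (2 * d + 1) ^ d / unitBallVol d * k, by positivity, fun n hkn f hf x hx => ?_⟩
  have hn : (0 : ℝ) < n := by exact_mod_cast hk.trans hkn
  have hsd : 0 < s + d := by positivity
  set t : ℝ := (n : ℝ) ^ (-(1 / (s + d))) with ht
  have ht0 : 0 < t := Real.rpow_pos_of_pos hn _
  have hts : t ^ s = (n : ℝ) ^ (-(s / (s + d))) := by
    rw [ht, ← Real.rpow_mul hn.le]
    congr 1
    ring
  have htd : t ^ d * n = ((n : ℝ) ^ (-(s / (s + d))))⁻¹ := by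
    rw [ht, ← Real.rpow_natCast, ← Real.rpow_mul hn.le, ← Real.rpow_add_one hn.ne',
      ← Real.rpow_neg hn.le]
    congr 1
    field_simp
    ring
  have hrate : (2 * d + 1) ^ d / (unitBallVol d * t ^ d) * (k / (n + 1)) ≤
      (2 * d + 1) ^ d / unitBallVol d * k * (n : ℝ) ^ (-(s / (s + d))) := by
    calc ((2 * d + 1) ^ d / (unitBallVol d * t ^ d) * (k / (n + 1)) : ℝ)
        ≤ (2 * d + 1) ^ d / (unitBallVol d * t ^ d) * (k / n) := by
          gcongr
          linarith
      _ = (2 * d + 1) ^ d / unitBallVol d * k * (t ^ d * n)⁻¹ := by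
          field_simp
      _ = _ := by rw [htd, inv_inv]
  have hmain := integral_ballAvg_RkOfPoint_le hd hk hkn hs hL.le hf hx ht0
  rw [hts] at hmain
  linarith

end
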